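/- Let V ⊊ ℂ be an unbounded simply connected domain with V ∩ {|z| ≤ 1} = ∅, and let f : V → W := {w ∈ ℂ : |w| > 1} be a holomorphic universal covering map (i.e. a holomorphic covering map of W defined on the simply connected domain V). Suppose that Σ_{z ∈ f⁻¹(w)} 1/(|z|²·|f′(z)|²) < ∞ for all w ∈ W. Let q : V → ℂ be holomorphic with |q(z)| ≤ C/|z|² for some constant C > 0 and all z ∈ V. Then for every w ∈ W the series Σ_{z ∈ f⁻¹(w)} q(z)/f′(z)² converges absolutely, and the function σ(w) := Σ_{z ∈ f⁻¹(w)} q(z)/f′(z)² satisfies |σ(w)| ≤ C′·(log|w|)²/|w|² for some constant C′ and all sufficiently large |w|; in particular σ(w) = o(1/|w|) as w → ∞. -/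

import Mathlib

open Complex Set Filter Topology Metric MeasureTheory
open scoped ENNReal Real

noncomputable def logPlus (x : ℝ) : ℝ := max 0 (Real.log x)

noncomputable def entireOrder (f : ℂ → ℂ) : ℝ≥0∞ :=
  Filter.limsup
    (fun z : ℂ => ENNReal.ofReal (logPlus (logPlus ‖f z‖) / Real.log ‖z‖))
    (Filter.comap (fun z : ℂ => ‖z‖) Filter.atTop)

def IsRegularValue (f : ℂ → ℂ) (w : ℂ) : Prop :=
  ∃ U : Set ℂ, IsOpen U ∧ w ∈ U ∧
    ∀ z ∈ f ⁻¹' U,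
      ∃ e : ↥(connectedComponentIn (f ⁻¹' U) z) ≃ₜ ↥U,
        ∀ x : ↥(connectedComponentIn (f ⁻¹' U) z), (e x : ℂ) = f ↑x

def singularSet (f : ℂ → ℂ) : Set ℂ := {w : ℂ | ¬ IsRegularValue f w}

def TranscendentalEntire (f : ℂ → ℂ) : Prop :=
  Differentiable ℂ f ∧ ¬ ∃ p : Polynomial ℂ, ∀ z, f z = p.eval z

def TopEquiv (f g : ℂ → ℂ) : Prop :=
  ∃ φ ψ : ℂ ≃ₜ ℂ, ∀ z, ψ (f z) = g (φ z)

noncomputable def cylArea (A : Set ℂ) : ℝ≥0∞ :=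
  ∫⁻ z in A, ENNReal.ofReal (1 / ‖z‖ ^ 2)

def AreaProperty (f : ℂ → ℂ) : Prop :=
  ∀ K : Set ℂ, IsCompact K → K ⊆ (singularSet f)ᶜ →
    cylArea (f ⁻¹' K \ Metric.ball (0 : ℂ) 1) < ⊤

/-- A Bloch-type bound: a holomorphic function on a disc whose image contains no two points
differing by `2πi` has derivative at the centre controlled by the radius. -/
theorem norm_deriv_mul_le_of_ne_add_two_pi_I {g : ℂ → ℂ} {z₀ : ℂ} {R : ℝ} (hR : 0 < R)
    (hg : DifferentiableOn ℂ g (ball z₀ R))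
    (hne : ∀ x ∈ ball z₀ R, ∀ y ∈ ball z₀ R, g x ≠ g y + 2 * π * I) :
    ‖deriv g z₀‖ * R ≤ 1000 := by
  have hsub : closedBall z₀ (R / 2) ⊆ ball z₀ R := closedBall_subset_ball (by linarith)
  have hgd : DifferentiableOn ℂ (deriv g) (ball z₀ R) := hg.deriv isOpen_ball
  obtain ⟨z₁, hz₁, hmax⟩ := (isCompact_closedBall z₀ (R / 2)).exists_isMaxOn
    (f := fun z => (R / 2 - dist z z₀) * ‖deriv g z‖) ⟨z₀, mem_closedBall_self (by linarith)⟩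
    ((by fun_prop : Continuous fun z => R / 2 - dist z z₀).continuousOn.mul
      (hgd.continuousOn.mono hsub).norm)
  have hmax' : ∀ z ∈ closedBall z₀ (R / 2), (R / 2 - dist z z₀) * ‖deriv g z‖ ≤
    (R / 2 - dist z₁ z₀) * ‖deriv g z₁‖ := fun z hz => hmax hz
  set a := ‖deriv g z₁‖ with ha
  set ρ := (R / 2 - dist z₁ z₀) / 2 with hρ
  have h2ρ : R / 2 - dist z₁ z₀ = 2 * ρ := by rw [hρ]; ring
  rw [h2ρ] at hmax'
  have h0 := hmax' z₀ (mem_closedBall_self (by linarith))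
  simp only [dist_self, sub_zero] at h0
  by_contra! hcon
  have hbig : 500 < 2 * ρ * a := by linarith
  have ha0 : 0 ≤ a := norm_nonneg _
  have hρ0 : 0 < ρ := by
    by_contra! h
    nlinarith
  have hapos : 0 < a := by
    by_contra! h
    nlinarith
  have hsub₁ : closedBall z₁ ρ ⊆ closedBall z₀ (R / 2) := by
    intro z hz
    rw [mem_closedBall] at *
    linarith [dist_triangle z z₁ z₀]
  have hbd : ∀ z ∈ closedBall z₁ ρ, ‖deriv g z‖ ≤ 2 * a := by
    intro z hz
    have h1 := hmax' z (hsub₁ hz)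
    rw [mem_closedBall] at hz
    have h2 : ρ ≤ R / 2 - dist z z₀ := by linarith [dist_triangle z z₁ z₀]
    have h3 : ρ * ‖deriv g z‖ ≤ ρ * (2 * a) := by
      nlinarith [norm_nonneg (deriv g z)]
    exact le_of_mul_le_mul_left h3 hρ0
  have hb : ball z₁ ρ ⊆ ball z₀ R := ball_subset_closedBall.trans (hsub₁.trans hsub)
  have hschw : ∀ z ∈ ball z₁ ρ, ‖deriv g z - deriv g z₁‖ ≤ 3 * a / ρ * dist z z₁ := by
    intro z hz
    rw [← dist_eq_norm]
    refine dist_le_div_mul_dist_of_mapsTo_ball (hgd.mono hb) (fun y hy => ?_) hz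
    rw [mem_closedBall, dist_eq_norm]
    linarith [norm_sub_le (deriv g y) (deriv g z₁), hbd y (ball_subset_closedBall hy)]
  have hs6 : closedBall z₁ (ρ / 6) ⊆ ball z₁ ρ := closedBall_subset_ball (by linarith)
  have hdiff : ∀ z ∈ closedBall z₁ (ρ / 6), DifferentiableAt ℂ g z := fun z hz =>
    hg.differentiableAt (isOpen_ball.mem_nhds (hb (hs6 hz)))
  have hlin : ∀ z ∈ closedBall z₁ (ρ / 6),
      ‖(g z - deriv g z₁ * z) - (g z₁ - deriv g z₁ * z₁)‖ ≤ a / 2 * ‖z - z₁‖ := by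
    intro z hz
    refine (convex_closedBall z₁ (ρ / 6)).norm_image_sub_le_of_norm_hasDerivWithin_le
      (f := fun z => g z - deriv g z₁ * z) (f' := fun z => deriv g z - deriv g z₁)
      (fun x hx => ?_) (fun x hx => ?_) (mem_closedBall_self (by linarith)) hz
    · have := (hdiff x hx).hasDerivAt.sub ((hasDerivAt_id x).const_mul (deriv g z₁))
      rw [mul_one] at this
      exact this.hasDerivWithinAt
    · refine (hschw x (hs6 hx)).trans ?_
      rw [mem_closedBall] at hx
      calc 3 * a / ρ * dist x z₁ ≤ 3 * a / ρ * (ρ / 6) := by gcongr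
        _ = a / 2 := by field_simp; norm_num
  have hlow : ∀ z ∈ closedBall z₁ (ρ / 6), a / 2 * ‖z - z₁‖ ≤ ‖g z - g z₁‖ := by
    intro z hz
    have h1 := hlin z hz
    have h2 : ‖deriv g z₁ * (z - z₁)‖ = a * ‖z - z₁‖ := norm_mul _ _
    have h3 : deriv g z₁ * (z - z₁) = (g z - g z₁) -
      ((g z - deriv g z₁ * z) - (g z₁ - deriv g z₁ * z₁)) := by ring
    rw [h3] at h2
    linarith [norm_sub_le (g z - g z₁) ((g z - deriv g z₁ * z) - (g z₁ - deriv g z₁ * z₁))]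
  have hfreq : ∃ᶠ z in 𝓝 z₁, g z ≠ g z₁ := by
    have := (hdiff z₁ (mem_closedBall_self (by linarith))).hasDerivAt.eventually_ne
      (c := g z₁) (norm_pos_iff.1 hapos)
    exact this.frequently.filter_mono nhdsWithin_le_nhds
  have himg := DiffContOnCl.ball_subset_image_closedBall (f := g) (z₀ := z₁) (r := ρ / 6)
    (ε := a / 2 * (ρ / 6))
    (hg.mono (closure_ball_subset_closedBall.trans (hs6.trans hb))).diffContOnCl (by linarith)
    (fun z hz => by
      have := hlow z (sphere_subset_closedBall hz)
      rwa [mem_sphere_iff_norm.1 hz] at this) hfreq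
  have hmem : g z₁ + 2 * π * I ∈ ball (g z₁) (a / 2 * (ρ / 6) / 2) := by
    have : ‖(2 * π * I : ℂ)‖ = 2 * π := by simp [Real.pi_pos.le]
    rw [mem_ball, dist_eq_norm, add_sub_cancel_left, this]
    linarith [Real.pi_lt_d2]
  obtain ⟨x, hx, hxe⟩ := himg hmem
  exact hne x (hb (hs6 hx)) z₁ (hb (mem_ball_self hρ0)) hxe

/-- A zero-free holomorphic function on a disc has a holomorphic logarithm. -/
theorem exists_exp_eq_of_differentiableOn_ball {h : ℂ → ℂ} {z₀ : ℂ} {R : ℝ} (hR : 0 < R)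
    (hh : DifferentiableOn ℂ h (ball z₀ R)) (h0 : ∀ z ∈ ball z₀ R, h z ≠ 0) :
    ∃ g : ℂ → ℂ, DifferentiableOn ℂ g (ball z₀ R) ∧ ∀ z ∈ ball z₀ R, exp (g z) = h z := by
  obtain ⟨G, hG⟩ := ((hh.deriv isOpen_ball).div hh h0).isExactOn_ball
  have hz₀ : z₀ ∈ ball z₀ R := mem_ball_self hR
  have hd : ∀ z ∈ ball z₀ R, HasDerivAt (fun z => h z * exp (-G z)) 0 z := by
    intro z hz
    have h1 := (hh.differentiableAt (isOpen_ball.mem_nhds hz)).hasDerivAt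
    have h3 : deriv h z * exp (-G z) + h z * (exp (-G z) * -(deriv h z / h z)) = 0 := by
      have := h0 z hz
      field_simp
      ring
    rw [← h3]
    exact h1.mul (hG z hz).neg.cexp
  refine ⟨fun z => G z + (log (h z₀) - G z₀), fun z hz =>
    ((hG z hz).differentiableAt.add_const _).differentiableWithinAt, fun z hz => ?_⟩
  have hconst := (convex_ball z₀ R).is_const_of_fderivWithin_eq_zero (𝕜 := ℂ)
    (f := fun z => h z * exp (-G z)) (fun z hz => (hd z hz).differentiableAt.differentiableWithinAt)
    (fun z hz => by
      rw [fderivWithin_of_isOpen isOpen_ball hz]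
      have := (hd z hz).hasFDerivAt.fderiv
      rw [this]; ext; simp) hz hz₀
  rw [exp_add, exp_sub, exp_log (h0 z₀ hz₀)]
  rw [exp_neg, exp_neg] at hconst
  have e1 := exp_ne_zero (G z)
  have e2 := exp_ne_zero (G z₀)
  field_simp at hconst ⊢
  linear_combination -hconst

/-- A weak Koebe one-quarter theorem. -/
theorem norm_deriv_mul_le_of_injOn {φ : ℂ → ℂ} {z₀ w : ℂ} {R : ℝ} (hR : 0 < R)
    (hφ : DifferentiableOn ℂ φ (ball z₀ R)) (hinj : InjOn φ (ball z₀ R))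
    (hw : ∀ z ∈ ball z₀ R, φ z ≠ w) :
    ‖deriv φ z₀‖ * R ≤ 1000 * ‖φ z₀ - w‖ := by
  obtain ⟨g, hg, hexp⟩ := exists_exp_eq_of_differentiableOn_ball hR (hφ.sub_const w)
    fun z hz => sub_ne_zero.2 (hw z hz)
  have hz₀ : z₀ ∈ ball z₀ R := mem_ball_self hR
  have key := norm_deriv_mul_le_of_ne_add_two_pi_I hR hg fun x hx y hy hxy => by
    have h1 : exp (g x) = exp (g y) := by rw [hxy, exp_add, exp_two_pi_mul_I, mul_one]
    rw [hexp x hx, hexp y hy, sub_left_inj] at h1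
    rw [hinj hx hy h1] at hxy
    exact two_pi_I_ne_zero (left_eq_add.1 hxy)
  have hder : deriv φ z₀ = (φ z₀ - w) * deriv g z₀ := by
    have h1 := (hg.differentiableAt (isOpen_ball.mem_nhds hz₀)).hasDerivAt.cexp
    rw [hexp z₀ hz₀] at h1
    have h2 : (fun z => exp (g z)) =ᶠ[𝓝 z₀] fun z => φ z - w := by
      filter_upwards [isOpen_ball.mem_nhds hz₀] with z hz using hexp z hz
    rw [← h1.deriv, h2.deriv_eq, deriv_sub_const_fun]
  rw [hder, norm_mul, mul_assoc, mul_comm (1000 : ℝ)]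
  gcongr

/-- A weak Koebe distortion theorem. -/
theorem distortion_of_injOn {φ : ℂ → ℂ} {z₀ z : ℂ} {R : ℝ} (hR : 0 < R)
    (hφ : DifferentiableOn ℂ φ (ball z₀ R)) (hinj : InjOn φ (ball z₀ R))
    (hd : deriv φ z₀ ≠ 0) (hz : dist z z₀ ≤ R / 4004) :
    ‖φ z - φ z₀‖ ≤ 2 * ‖deriv φ z₀‖ * (R / 4004) ∧ ‖deriv φ z‖ ≤ 4 * ‖deriv φ z₀‖ := by
  have hz₀ : z₀ ∈ ball z₀ R := mem_ball_self hR
  have hlow : ∀ x ∈ ball z₀ R, ‖deriv φ z₀‖ ≤ 1000 * ‖dslope φ z₀ x‖ := by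
    intro x hx
    rcases eq_or_ne x z₀ with rfl | hne
    · rw [dslope_same]; linarith [norm_nonneg (deriv φ x)]
    have hpos : 0 < dist x z₀ := dist_pos.2 hne
    have hsub : ball z₀ (dist x z₀) ⊆ ball z₀ R := ball_subset_ball (mem_ball.1 hx).le
    have := norm_deriv_mul_le_of_injOn hpos (hφ.mono hsub) (hinj.mono hsub) (w := φ x)
      fun y hy hyx => by
        rw [hinj (hsub hy) hx hyx] at hy
        exact lt_irrefl _ (mem_ball.1 hy)
    rw [dslope_of_ne _ hne, slope_def_field, norm_div, ← dist_eq_norm x, ← mul_div_assoc,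
      le_div_iff₀ hpos, norm_sub_rev]
    exact this
  have hne : ∀ x ∈ ball z₀ R, dslope φ z₀ x ≠ 0 := fun x hx h => by
    have := hlow x hx
    rw [h, norm_zero, mul_zero] at this
    exact hd (norm_le_zero_iff.1 this)
  have hup : ∀ x, dist x z₀ ≤ R / 2002 → ‖φ x - φ z₀‖ ≤ 2 * ‖deriv φ z₀‖ * dist x z₀ := by
    intro x hx
    have hxb : x ∈ ball z₀ R := by rw [mem_ball]; linarith
    have hu : DifferentiableOn ℂ (fun x => deriv φ z₀ / dslope φ z₀ x) (ball z₀ R) :=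
      (differentiableOn_const _).div
        ((Complex.differentiableOn_dslope (isOpen_ball.mem_nhds hz₀)).2 hφ) hne
    have hle : ∀ y ∈ ball z₀ R, ‖deriv φ z₀ / dslope φ z₀ y‖ ≤ 1000 := fun y hy => by
      rw [norm_div, div_le_iff₀ (norm_pos_iff.2 (hne y hy))]
      exact hlow y hy
    have hs := dist_le_div_mul_dist_of_mapsTo_ball (R₂ := 1001) hu (fun y hy => by
      rw [mem_closedBall, dist_eq_norm]
      refine (norm_sub_le _ _).trans ?_
      rw [dslope_same, div_self hd, norm_one]
      linarith [hle y hy]) hxb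
    rw [dslope_same, div_self hd] at hs
    have hhalf : 1001 / R * dist x z₀ ≤ 1 / 2 := by
      calc 1001 / R * dist x z₀ ≤ 1001 / R * (R / 2002) := by gcongr
        _ = 1 / 2 := by field_simp; norm_num
    have h1 : 1 / 2 ≤ ‖deriv φ z₀ / dslope φ z₀ x‖ := by
      have := norm_sub_norm_le 1 (deriv φ z₀ / dslope φ z₀ x)
      rw [norm_sub_rev, ← dist_eq_norm, norm_one] at this
      linarith
    rw [norm_div, le_div_iff₀ (norm_pos_iff.2 (hne x hxb))] at h1
    have h2 : ‖dslope φ z₀ x‖ ≤ 2 * ‖deriv φ z₀‖ := by linarith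
    rw [← sub_smul_dslope φ z₀ x, norm_smul, ← dist_eq_norm, mul_comm]
    gcongr
  have hρ : 0 < R / 4004 := by positivity
  refine ⟨(hup z (by linarith)).trans (by gcongr), ?_⟩
  have hcl : closedBall z (R / 4004) ⊆ ball z₀ R := fun x hx => by
    rw [mem_ball]
    rw [mem_closedBall] at hx
    linarith [dist_triangle x z z₀]
  have hc := norm_deriv_le_of_forall_mem_sphere_norm_le (f := fun x => φ x - φ z₀) hρ
    (((hφ.sub_const _).mono (closure_ball_subset_closedBall.trans hcl)).diffContOnCl)
    (C := 2 * ‖deriv φ z₀‖ * (R / 2002)) fun x hx => by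
      have hx' : dist x z₀ ≤ R / 2002 := by
        linarith [dist_triangle x z z₀, mem_sphere.1 hx]
      exact (hup x hx').trans (by gcongr)
  rw [deriv_sub_const_fun] at hc
  refine hc.trans_eq ?_
  field_simp
  norm_num

/-- Harnack-type comparison for the logarithmic derivative of a zero-free univalent function. -/
theorem norm_logDeriv_le_of_injOn {φ : ℂ → ℂ} {z₀ z : ℂ} {R : ℝ} (hR : 0 < R)
    (hφ : DifferentiableOn ℂ φ (ball z₀ R)) (hinj : InjOn φ (ball z₀ R))
    (h0 : ∀ z ∈ ball z₀ R, φ z ≠ 0) (hd : deriv φ z₀ ≠ 0) (hz : dist z z₀ ≤ R / 4004) :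
    ‖logDeriv φ z‖ ≤ 8 * ‖logDeriv φ z₀‖ := by
  obtain ⟨h1, h2⟩ := distortion_of_injOn hR hφ hinj hd hz
  have h3 := norm_deriv_mul_le_of_injOn hR hφ hinj h0
  rw [sub_zero] at h3
  have h4 : ‖φ z₀‖ / 2 ≤ ‖φ z‖ := by
    have := norm_sub_norm_le (φ z₀) (φ z)
    rw [norm_sub_rev] at this
    have := norm_nonneg (φ z₀)
    linarith
  have h5 : 0 < ‖φ z₀‖ := norm_pos_iff.2 (h0 z₀ (mem_ball_self hR))
  rw [logDeriv_apply, logDeriv_apply, norm_div, norm_div]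
  calc ‖deriv φ z‖ / ‖φ z‖ ≤ (4 * ‖deriv φ z₀‖) / (‖φ z₀‖ / 2) := by gcongr
    _ = 8 * (‖deriv φ z₀‖ / ‖φ z₀‖) := by field_simp; norm_num

/-- The Phragmén–Lindelöf principle for bounded functions on the right half-plane. -/
theorem norm_le_of_bounded_right_half_plane {G : ℂ → ℂ} {B M : ℝ}
    (hd : DiffContOnCl ℂ G {z | 0 < z.re}) (hB : ∀ z : ℂ, 0 ≤ z.re → ‖G z‖ ≤ B)
    (hM : ∀ x : ℝ, ‖G (x * I)‖ ≤ M) {z : ℂ} (hz : 0 ≤ z.re) : ‖G z‖ ≤ M := by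
  have hnorm : ∀ (ε : ℝ) (z : ℂ), ‖G z * exp (-ε * z)‖ = ‖G z‖ * Real.exp (-ε * z.re) := by
    intro ε z
    rw [norm_mul, norm_exp]
    simp
  have hε : ∀ ε : ℝ, 0 < ε → ‖G z‖ * Real.exp (-ε * z.re) ≤ M := by
    intro ε hε
    rw [← hnorm]
    refine PhragmenLindelof.right_half_plane_of_tendsto_zero_on_real
      (f := fun z => G z * exp (-ε * z)) ?_ ⟨1, by norm_num, 0, ?_⟩ ?_ ?_ hz
    · exact hd.smul (by fun_prop : Differentiable ℂ fun z : ℂ => exp (-ε * z)).diffContOnCl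
    · refine Asymptotics.IsBigO.of_bound B ?_
      filter_upwards [mem_inf_of_right (mem_principal_self _)] with x hx
      have hx : 0 < x.re := hx
      rw [hnorm]
      simp only [zero_mul, Real.exp_zero, norm_one, mul_one]
      refine (mul_le_of_le_one_right (norm_nonneg _) ?_).trans (hB x hx.le)
      exact Real.exp_le_one_iff.2 (by nlinarith)
    · have h1 : Tendsto (fun x : ℝ => B * Real.exp (-(ε * x))) atTop (𝓝 (B * 0)) :=
        (Real.tendsto_exp_neg_atTop_nhds_zero.comp
          (tendsto_id.const_mul_atTop hε)).const_mul B
      rw [mul_zero] at h1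
      refine squeeze_zero_norm' ?_ h1
      filter_upwards [eventually_ge_atTop 0] with x hx
      rw [hnorm, ofReal_re, neg_mul]
      gcongr
      exact hB x (by simpa using hx)
    · intro x
      rw [hnorm]
      simpa using hM x
  have hlim : Tendsto (fun ε : ℝ => ‖G z‖ * Real.exp (-ε * z.re)) (𝓝[>] 0) (𝓝 (‖G z‖ * 1)) := by
    have : Continuous fun ε : ℝ => ‖G z‖ * Real.exp (-ε * z.re) := by fun_prop
    have := this.tendsto 0
    simp only [neg_zero, zero_mul, Real.exp_zero] at this
    exact this.mono_left nhdsWithin_le_nhds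
  rw [mul_one] at hlim
  exact le_of_tendsto hlim (eventually_mem_nhdsWithin.mono fun ε h => hε ε h)

theorem ball_subset_right_half_plane {z : ℂ} (hz : 1 ≤ z.re) : ball z 1 ⊆ {z | 0 < z.re} := by
  intro x hx
  rw [mem_ball, dist_eq_norm] at hx
  have := (abs_le.1 (abs_re_le_norm (x - z))).1
  rw [sub_re] at this
  simp only [mem_ofPred_eq]
  linarith

section UnivalentHalfPlane

variable {φ : ℂ → ℂ}

theorem norm_logDeriv_le_of_one_le_re
    (hφ : DifferentiableOn ℂ φ {z | 0 < z.re}) (hinj : InjOn φ {z | 0 < z.re})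
    (h0 : ∀ z : ℂ, 0 < z.re → φ z ≠ 0) {z : ℂ} (hz : 1 ≤ z.re) : ‖logDeriv φ z‖ ≤ 1000 := by
  have hb := ball_subset_right_half_plane hz
  have := norm_deriv_mul_le_of_injOn one_pos (hφ.mono hb) (hinj.mono hb) (w := 0)
    fun x hx => h0 x (hb hx)
  rw [logDeriv_apply, norm_div, div_le_iff₀ (norm_pos_iff.2 (h0 z (by linarith)))]
  simpa using this

theorem norm_logDeriv_add_mul_I_le
    (hφ : DifferentiableOn ℂ φ {z | 0 < z.re}) (hinj : InjOn φ {z | 0 < z.re})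
    (h0 : ∀ z : ℂ, 0 < z.re → φ z ≠ 0)
    (hd : ∀ z : ℂ, 0 < z.re → deriv φ z ≠ 0) {z : ℂ} (hz : 1 ≤ z.re) (n : ℕ) (y : ℝ)
    (hy : |y| ≤ n / 4004) : ‖logDeriv φ (z + y * I)‖ ≤ 8 ^ n * ‖logDeriv φ z‖ := by
  induction n generalizing y with
  | zero =>
    have : y = 0 := by simpa using hy
    simp [this]
  | succ n ih =>
    have hn : (0 : ℝ) < n + 1 := by positivity
    push_cast at hy
    have h1 : |y * (n / (n + 1))| ≤ n / 4004 := by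
      rw [abs_mul, abs_of_nonneg (by positivity : (0 : ℝ) ≤ n / (n + 1))]
      calc |y| * (n / (n + 1)) ≤ (n + 1) / 4004 * (n / (n + 1)) := by gcongr
        _ = n / 4004 := by field_simp
    have h2 := ih _ h1
    set z₁ : ℂ := z + (y * (n / (n + 1)) : ℝ) * I with hz₁
    have hre : 1 ≤ z₁.re := by
      rw [hz₁, add_re, re_ofReal_mul, I_re, mul_zero, add_zero]
      exact hz
    have hb := ball_subset_right_half_plane hre
    have hdist : dist (z + y * I) z₁ ≤ 1 / 4004 := by
      have : z + y * I - z₁ = ((y / (n + 1) : ℝ) : ℂ) * I := by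
        have : ((n : ℂ) + 1) ≠ 0 := by exact_mod_cast hn.ne'
        rw [hz₁]
        push_cast
        field_simp
        ring
      rw [dist_eq_norm, this, norm_mul, norm_I, mul_one, norm_real, Real.norm_eq_abs, abs_div,
        abs_of_pos hn, div_le_iff₀ hn]
      linarith
    have h3 := norm_logDeriv_le_of_injOn one_pos (hφ.mono hb) (hinj.mono hb)
      (fun x hx => h0 x (hb hx)) (hd z₁ (by linarith)) hdist
    calc _ ≤ _ := h3
      _ ≤ 8 * (8 ^ n * ‖logDeriv φ z‖) := by gcongr
      _ = _ := by ring

theorem exists_sum_sq_logDeriv_le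
    (hφ : DifferentiableOn ℂ φ {z | 0 < z.re}) (hinj : InjOn φ {z | 0 < z.re})
    (h0 : ∀ z : ℂ, 0 < z.re → φ z ≠ 0) (hd : ∀ z : ℂ, 0 < z.re → deriv φ z ≠ 0)
    (hsum : Summable fun k : ℤ => ‖logDeriv φ (1 + k * (2 * π * I))‖ ^ 2) :
    ∃ M : ℝ, 0 ≤ M ∧ ∀ (s : Finset ℤ) (y : ℝ),
      ∑ k ∈ s, ‖logDeriv φ (1 + y * I + k * (2 * π * I))‖ ^ 2 ≤ M := by
  obtain ⟨N, hN⟩ := exists_nat_ge (2 * π * 4004)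
  refine ⟨(8 ^ N) ^ 2 * ∑' k : ℤ, ‖logDeriv φ (1 + k * (2 * π * I))‖ ^ 2,
    mul_nonneg (by positivity) (tsum_nonneg fun _ => by positivity), fun s y => ?_⟩
  have h2π : 0 < 2 * π := by positivity
  set m : ℤ := ⌊y / (2 * π)⌋ with hm
  set y₀ : ℝ := y - m * (2 * π) with hy₀
  have hy : |y₀| ≤ N / 4004 := by
    have e1 := Int.floor_le (y / (2 * π))
    have e2 := (Int.lt_floor_add_one (y / (2 * π))).le
    rw [le_div_iff₀ h2π] at e1
    rw [div_le_iff₀ h2π] at e2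
    rw [abs_of_nonneg (by rw [hy₀]; linarith), le_div_iff₀ (by norm_num)]
    nlinarith
  have hterm : ∀ k : ℤ, ‖logDeriv φ (1 + y * I + k * (2 * π * I))‖ ^ 2 ≤
      (8 ^ N) ^ 2 * ‖logDeriv φ (1 + ((k + m : ℤ) : ℂ) * (2 * π * I))‖ ^ 2 := by
    intro k
    have := norm_logDeriv_add_mul_I_le hφ hinj h0 hd
      (z := 1 + ((k + m : ℤ) : ℂ) * (2 * π * I)) (by simp) N y₀ hy
    rw [← mul_pow]
    have e : (1 + y * I + k * (2 * π * I) : ℂ) = 1 + ((k + m : ℤ) : ℂ) * (2 * π * I) + y₀ * I := by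
      rw [hy₀]; push_cast; ring
    rw [e]
    gcongr
  calc _ ≤ ∑ k ∈ s, (8 ^ N) ^ 2 * ‖logDeriv φ (1 + ((k + m : ℤ) : ℂ) * (2 * π * I))‖ ^ 2 :=
        Finset.sum_le_sum fun k _ => hterm k
    _ = (8 ^ N) ^ 2 * ∑ k ∈ s.map (Equiv.addRight m).toEmbedding,
          ‖logDeriv φ (1 + k * (2 * π * I))‖ ^ 2 := by
        rw [Finset.sum_map, Finset.mul_sum]; rfl
    _ ≤ _ := by
        gcongr
        exact hsum.sum_le_tsum _ fun _ _ => by positivity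

theorem exists_norm_sum_pullback_le
    (hφ : DifferentiableOn ℂ φ {z | 0 < z.re}) (hinj : InjOn φ {z | 0 < z.re})
    (h0 : ∀ z : ℂ, 0 < z.re → φ z ≠ 0) (hd : ∀ z : ℂ, 0 < z.re → deriv φ z ≠ 0)
    (hsum : Summable fun k : ℤ => ‖logDeriv φ (1 + k * (2 * π * I))‖ ^ 2)
    {Q : ℂ → ℂ} (hQ : DifferentiableOn ℂ Q {z | 0 < z.re}) {C : ℝ} (hC : 0 ≤ C)
    (hQC : ∀ z : ℂ, 0 < z.re → ‖Q z‖ ≤ C * ‖logDeriv φ z‖ ^ 2) :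
    ∃ M : ℝ, 0 ≤ M ∧ ∀ (s : Finset ℤ) (z : ℂ), 1 ≤ z.re →
      ‖∑ k ∈ s, Q (z + k * (2 * π * I))‖ ≤ M := by
  obtain ⟨M, hM0, hM⟩ := exists_sum_sq_logDeriv_le hφ hinj h0 hd hsum
  refine ⟨C * M, by positivity, fun s z hz => ?_⟩
  have key := norm_le_of_bounded_right_half_plane (M := C * M) (B := ∑ k ∈ s, C * 1000 ^ 2)
    (G := fun z => ∑ k ∈ s, Q (z + 1 + k * (2 * π * I))) (z := z - 1) ?_ ?_ ?_ (by simpa using hz)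
  · simpa using key
  · refine DifferentiableOn.diffContOnCl (DifferentiableOn.fun_sum fun k _ => ?_)
    refine hQ.comp (by fun_prop) fun x hx => ?_
    have hx' : 0 ≤ x.re := by
      have : closure {z : ℂ | 0 < z.re} ⊆ {z : ℂ | 0 ≤ z.re} :=
        closure_minimal (ofPred_subset_ofPred.2 fun z hz => le_of_lt hz) (isClosed_le continuous_const continuous_re)
      exact this hx
    simp only [mem_ofPred_eq]
    simp
    linarith
  · intro x hx
    refine (norm_sum_le _ _).trans (Finset.sum_le_sum fun k _ => ?_)
    have hre : 1 ≤ (x + 1 + k * (2 * π * I)).re := by simpa using hx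
    refine (hQC _ (by linarith)).trans ?_
    gcongr
    exact norm_logDeriv_le_of_one_le_re hφ hinj h0 hre
  · intro y
    refine (norm_sum_le _ _).trans ?_
    refine le_trans ?_ (mul_le_mul_of_nonneg_left (hM s y) hC)
    rw [Finset.mul_sum]
    refine Finset.sum_le_sum fun k _ => ?_
    have e : (y * I + 1 + k * (2 * π * I) : ℂ) = 1 + y * I + k * (2 * π * I) := by ring
    rw [e]
    exact hQC _ (by simp)

end UnivalentHalfPlane

/-- A covering of the exterior of the unit disc by a simply connected planar domain is uniformized
by the exponential map on the right half-plane. -/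
theorem exists_uniformization {V : Set ℂ} (hVopen : IsOpen V) [SimplyConnectedSpace V]
    {f : ℂ → ℂ} (hf : ContinuousOn f V) (hmaps : MapsTo f V {w : ℂ | 1 < ‖w‖})
    (hcov : IsCoveringMap (MapsTo.restrict f V {w : ℂ | 1 < ‖w‖} hmaps)) :
    ∃ φ : ℂ → ℂ, ContinuousOn φ {z | 0 < z.re} ∧ BijOn φ {z | 0 < z.re} V ∧
      ∀ z : ℂ, 0 < z.re → f (φ z) = exp z := by
  let H : Set ℂ := {z | 0 < z.re}
  have hHo : IsOpen H := isOpen_lt continuous_const continuous_re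
  have : ContractibleSpace H := (convex_halfSpace_re_gt 0).contractibleSpace ⟨1, by simp⟩
  have : LocallyPathConnectedSpace H := hHo.locallyPathConnectedSpace
  have : LocallyPathConnectedSpace V := hVopen.locallyPathConnectedSpace
  have hmem : ∀ z w : ℂ, exp z = w → (0 < z.re ↔ 1 < ‖w‖) := by
    rintro z _ rfl
    rw [norm_exp, Real.one_lt_exp_iff]
  obtain ⟨v₀⟩ : Nonempty V := inferInstance
  have hfv : ∀ v : V, 1 < ‖f v‖ := fun v => hmaps v.2
  have hfv0 : ∀ v : V, f v ≠ 0 := fun v => norm_pos_iff.1 (one_pos.trans (hfv v))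
  let h₀ : H := ⟨log (f v₀), (hmem _ _ (exp_log (hfv0 v₀))).2 (hfv v₀)⟩
  let e : C(H, {w : ℂ | 1 < ‖w‖}) := ⟨fun z => ⟨exp z, (hmem z _ rfl).1 z.2⟩, by fun_prop⟩
  obtain ⟨F, ⟨hF0, hF⟩, -⟩ := hcov.existsUnique_continuousMap_lifts e h₀ v₀
    (Subtype.ext (exp_log (hfv0 v₀)).symm)
  have hF' : ∀ z : H, f (F z) = exp z := fun z => congrArg Subtype.val (congrFun hF z)
  let fV : C(V, {z : ℂ // z ≠ 0}) :=
    ⟨fun v => ⟨f v, hfv0 v⟩, (continuousOn_iff_continuous_domRestrict.1 hf).subtype_mk _⟩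
  obtain ⟨L, ⟨hL0, hL⟩, -⟩ := isCoveringMap_exp.existsUnique_continuousMap_lifts fV v₀ h₀
    (Subtype.ext (exp_log (hfv0 v₀)))
  have hL' : ∀ v : V, exp (L v) = f v := fun v => congrArg Subtype.val (congrFun hL v)
  let L' : V → H := fun v => ⟨L v, (hmem _ _ (hL' v)).2 (hfv v)⟩
  have hLc : Continuous L' := L.continuous.subtype_mk _
  have hLF : (fun z : H => L (F z)) = Subtype.val := by
    refine isCoveringMap_exp.eq_of_comp_eq (by fun_prop) continuous_subtype_val ?_ h₀ ?_
    · ext z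
      simp [hL', hF']
    · simp only [hF0, hL0]
  have hFL : (fun v : V => F (L' v)) = id := by
    refine hcov.eq_of_comp_eq (by fun_prop) continuous_id ?_ v₀ ?_
    · ext v
      exact (hF' (L' v)).trans (hL' v)
    · have : L' v₀ = h₀ := Subtype.ext hL0
      simp only [this, hF0, id]
  classical
  have hφ : ∀ z : H, (fun z => if h : z ∈ H then (F ⟨z, h⟩ : ℂ) else 0) z = F z := fun z => by simp
  refine ⟨fun z => if h : z ∈ H then F ⟨z, h⟩ else 0, ?_, ⟨fun z hz => ?_, fun z hz z' hz' h => ?_,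
    fun v hv => ⟨L' ⟨v, hv⟩, (L' ⟨v, hv⟩).2, ?_⟩⟩, fun z hz => ?_⟩
  · rw [continuousOn_iff_continuous_domRestrict]
    exact (continuous_subtype_val.comp F.continuous).congr fun z => (hφ z).symm
  · exact (hφ ⟨z, hz⟩).symm ▸ (F ⟨z, hz⟩).2
  · have h2 : F ⟨z, hz⟩ = F ⟨z', hz'⟩ := by
      refine Subtype.ext ?_
      rw [← hφ, ← hφ]
      exact h
    exact (congrFun hLF ⟨z, hz⟩).symm.trans ((congrArg L h2).trans (congrFun hLF ⟨z', hz'⟩))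
  · exact (hφ _).trans (congrArg Subtype.val (congrFun hFL ⟨v, hv⟩))
  · exact (congrArg f (hφ ⟨z, hz⟩)).trans (hF' ⟨z, hz⟩)

/-- A continuous local lift of a function with non-vanishing derivative through a holomorphic
function is holomorphic, and both derivatives are related by the chain rule. -/
theorem hasDerivAt_of_comp_eq {f φ h : ℂ → ℂ} {U V : Set ℂ} (hU : IsOpen U) (hV : IsOpen V)
    (hf : DifferentiableOn ℂ f V) (hφ : ContinuousOn φ U) (hmaps : MapsTo φ U V)
    (hinj : InjOn φ U) (hh : ∀ z ∈ U, DifferentiableAt ℂ h z) (hh' : ∀ z ∈ U, deriv h z ≠ 0)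
    (hcomp : ∀ z ∈ U, f (φ z) = h z) {z₀ : ℂ} (hz₀ : z₀ ∈ U) :
    DifferentiableAt ℂ φ z₀ ∧ deriv f (φ z₀) * deriv φ z₀ = deriv h z₀ := by
  have hφc : ∀ z ∈ U, ContinuousAt φ z := fun z hz => hφ.continuousAt (hU.mem_nhds hz)
  have hft : ∀ z ∈ V, DifferentiableAt ℂ f z := fun z hz => hf.differentiableAt (hV.mem_nhds hz)
  have hregular : ∀ z ∈ U, deriv f (φ z) ≠ 0 → DifferentiableAt ℂ φ z := fun z hz hne =>
    (HasDerivAt.of_comp_left (hφc z hz) (hft _ (hmaps hz)).hasDerivAt (hh z hz).hasDerivAt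
      hne (by filter_upwards [hU.mem_nhds hz] with x hx using hcomp x hx)).differentiableAt
  have hev : ∀ᶠ y in 𝓝[≠] (φ z₀), deriv f y ≠ 0 := by
    have han : AnalyticAt ℂ (deriv f) (φ z₀) :=
      (hf.analyticAt (hV.mem_nhds (hmaps hz₀))).deriv
    refine han.eventually_eq_zero_or_eventually_ne_zero.resolve_left fun hzero => ?_
    obtain ⟨r, hr, hball⟩ := Metric.eventually_nhds_iff_ball.1
      (hzero.and (hV.mem_nhds (hmaps hz₀)))
    have hconst : ∀ y ∈ ball (φ z₀) r, f y = f (φ z₀) := fun y hy =>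
      (convex_ball (φ z₀) r).is_const_of_fderivWithin_eq_zero (𝕜 := ℂ)
        (fun x hx => (hft x (hball x hx).2).differentiableWithinAt)
        (fun x hx => by
          rw [fderivWithin_of_isOpen isOpen_ball hx]
          ext
          simpa using (hball x hx).1) hy (mem_ball_self hr)
    have hloc : h =ᶠ[𝓝 z₀] fun _ => h z₀ := by
      filter_upwards [(hφc z₀ hz₀).preimage_mem_nhds (ball_mem_nhds _ hr), hU.mem_nhds hz₀]
        with x hx hxU
      rw [← hcomp x hxU, ← hcomp z₀ hz₀]
      exact hconst _ hx
    exact hh' z₀ hz₀ (by rw [hloc.deriv_eq, deriv_const])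
  have htend : Tendsto φ (𝓝[≠] z₀) (𝓝[≠] (φ z₀)) := by
    refine tendsto_nhdsWithin_iff.2 ⟨(hφc z₀ hz₀).tendsto.mono_left nhdsWithin_le_nhds, ?_⟩
    filter_upwards [nhdsWithin_le_nhds (hU.mem_nhds hz₀), self_mem_nhdsWithin] with x hx hne h
    exact hne (hinj hx hz₀ h)
  have hdiff : DifferentiableAt ℂ φ z₀ := by
    refine (analyticAt_of_differentiable_on_punctured_nhds_of_continuousAt ?_
      (hφc z₀ hz₀)).differentiableAt
    filter_upwards [htend.eventually hev, nhdsWithin_le_nhds (hU.mem_nhds hz₀)] with x hx hxU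
    exact hregular x hxU hx
  refine ⟨hdiff, ?_⟩
  have hchain := (hft _ (hmaps hz₀)).hasDerivAt.comp z₀ hdiff.hasDerivAt
  have hloc : f ∘ φ =ᶠ[𝓝 z₀] h := by
    filter_upwards [hU.mem_nhds hz₀] with x hx using hcomp x hx
  rw [← hchain.deriv, hloc.deriv_eq]


theorem exists_int_equiv_fiber {f φ : ℂ → ℂ} {V : Set ℂ} (hbij : BijOn φ {z | 0 < z.re} V)
    (hcomp : ∀ z : ℂ, 0 < z.re → f (φ z) = exp z) {z₀ w : ℂ} (hz₀ : 0 < z₀.re)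
    (hw : exp z₀ = w) :
    ∃ E : ℤ ≃ {z : ℂ // z ∈ V ∧ f z = w},
      ∀ k : ℤ, (E k : ℂ) = φ (z₀ + k * (2 * π * I)) := by
  subst hw
  have hre : ∀ k : ℤ, z₀ + k * (2 * π * I) ∈ {z : ℂ | 0 < z.re} := fun k => by simpa using hz₀
  refine ⟨Equiv.ofBijective (fun k => ⟨φ (z₀ + k * (2 * π * I)), hbij.mapsTo (hre k), ?_⟩)
    ⟨fun k l hkl => ?_, ?_⟩, fun k => rfl⟩
  · rw [hcomp _ (hre k), exp_add, exp_int_mul_two_pi_mul_I, mul_one]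
  · have := hbij.injOn (hre k) (hre l) (congrArg Subtype.val hkl)
    simpa [two_pi_I_ne_zero] using this
  · rintro ⟨z, hz, hfz⟩
    obtain ⟨ζ, hζ, rfl⟩ := hbij.surjOn hz
    rw [hcomp ζ hζ] at hfz
    obtain ⟨k, rfl⟩ := exp_eq_exp_iff_exists_int.1 hfz
    exact ⟨k, rfl⟩

theorem pushforward_double_pole (V : Set ℂ)
    (hVopen : IsOpen V) (hVne : V ≠ Set.univ)
    (hVunb : ¬ Bornology.IsBounded V) (hVconn : IsConnected V)
    (hVsc : SimplyConnectedSpace ↥V)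
    (hVdisj : ∀ z ∈ V, 1 < ‖z‖)
    (f : ℂ → ℂ) (hf : DifferentiableOn ℂ f V)
    (hmaps : Set.MapsTo f V {w : ℂ | 1 < ‖w‖})
    (hcov : IsCoveringMap (Set.MapsTo.restrict f V {w : ℂ | 1 < ‖w‖} hmaps))
    (harea : ∀ w : ℂ, 1 < ‖w‖ →
      Summable (fun z : {z : ℂ // z ∈ V ∧ f z = w} =>
        1 / (‖(z : ℂ)‖ ^ 2 * ‖deriv f (z : ℂ)‖ ^ 2)))
    (q : ℂ → ℂ) (hq : DifferentiableOn ℂ q V)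
    (C : ℝ) (hC : 0 < C) (hqbound : ∀ z ∈ V, ‖q z‖ ≤ C / ‖z‖ ^ 2) :
    (∀ w : ℂ, 1 < ‖w‖ →
      Summable (fun z : {z : ℂ // z ∈ V ∧ f z = w} =>
        ‖q (z : ℂ) / (deriv f (z : ℂ)) ^ 2‖)) ∧
    ∃ C' R : ℝ, 0 < C' ∧ 1 < R ∧ ∀ w : ℂ, R ≤ ‖w‖ →
      ‖∑' z : {z : ℂ // z ∈ V ∧ f z = w}, q (z : ℂ) / (deriv f (z : ℂ)) ^ 2‖ ≤
        C' * Real.log ‖w‖ ^ 2 / ‖w‖ ^ 2 := by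
  have hVne0 : ∀ z ∈ V, z ≠ 0 := fun z hz => norm_pos_iff.1 (one_pos.trans (hVdisj z hz))
  have hsummable : ∀ w : ℂ, 1 < ‖w‖ → Summable (fun z : {z : ℂ // z ∈ V ∧ f z = w} =>
      ‖q (z : ℂ) / (deriv f (z : ℂ)) ^ 2‖) := fun w hw => by
    refine ((harea w hw).mul_left C).of_nonneg_of_le (fun _ => norm_nonneg _) fun z => ?_
    rw [norm_div, norm_pow]
    calc _ ≤ (C / ‖(z : ℂ)‖ ^ 2) / ‖deriv f (z : ℂ)‖ ^ 2 := by
          gcongr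
          exact hqbound z z.2.1
      _ = _ := by rw [div_div, mul_one_div]
  refine ⟨hsummable, ?_⟩
  obtain ⟨φ, hφc, hbij, hcomp⟩ := exists_uniformization hVopen hf.continuousOn hmaps hcov
  have hHo : IsOpen {z : ℂ | 0 < z.re} := isOpen_lt continuous_const continuous_re
  have hφ' : ∀ z : ℂ, 0 < z.re → DifferentiableAt ℂ φ z ∧ deriv f (φ z) * deriv φ z = exp z := by
    intro z hz
    have := hasDerivAt_of_comp_eq hHo hVopen hf hφc hbij.mapsTo hbij.injOn (h := exp)
      (fun _ _ => differentiableAt_exp) (fun x _ => by simp) hcomp hz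
    rwa [Complex.deriv_exp] at this
  have hφd : DifferentiableOn ℂ φ {z | 0 < z.re} := fun z hz =>
    (hφ' z hz).1.differentiableWithinAt
  have h0 : ∀ z : ℂ, 0 < z.re → φ z ≠ 0 := fun z hz => hVne0 _ (hbij.mapsTo hz)
  have hd : ∀ z : ℂ, 0 < z.re → deriv φ z ≠ 0 := fun z hz h => by
    have := (hφ' z hz).2
    rw [h, mul_zero] at this
    exact exp_ne_zero z this.symm
  have hfd : ∀ z : ℂ, 0 < z.re → deriv f (φ z) = exp z / deriv φ z := fun z hz =>
    eq_div_of_mul_eq (hd z hz) (hφ' z hz).2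
  have hexp : ∀ (z : ℂ) (k : ℤ), exp (z + k * (2 * π * I)) = exp z := fun z k => by
    rw [exp_add, exp_int_mul_two_pi_mul_I, mul_one]
  have hsum : Summable fun k : ℤ => ‖logDeriv φ (1 + k * (2 * π * I))‖ ^ 2 := by
    obtain ⟨E, hE⟩ := exists_int_equiv_fiber hbij hcomp (z₀ := 1) (by simp) rfl
    refine ((E.summable_iff.2 (harea (exp 1) (by simp [norm_exp]))).mul_left
      (‖exp 1‖ ^ 2)).congr fun k => ?_
    have hre : 0 < (1 + k * (2 * π * I) : ℂ).re := by simp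
    have e1 := norm_pos_iff.2 (hd _ hre)
    have e2 := norm_pos_iff.2 (h0 _ hre)
    have e3 := norm_pos_iff.2 (exp_ne_zero 1)
    simp only [Function.comp_apply, hE, hfd _ hre, hexp, logDeriv_apply, norm_div]
    field_simp
  obtain ⟨M, hM0, hM⟩ := exists_norm_sum_pullback_le hφd hbij.injOn h0 hd hsum
    (Q := fun z => q (φ z) * deriv φ z ^ 2)
    ((hq.comp hφd hbij.mapsTo).mul ((hφd.deriv hHo).pow 2)) hC.le fun z hz => by
      rw [norm_mul, norm_pow, logDeriv_apply, norm_div, div_pow, mul_div_left_comm, mul_comm]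
      gcongr
      exact hqbound _ (hbij.mapsTo hz)
  refine ⟨M + 1, Real.exp 1, by linarith, by simp, fun w hw => ?_⟩
  have hw1 : 1 < ‖w‖ := lt_of_lt_of_le (by simp) hw
  have hw0 : w ≠ 0 := norm_pos_iff.1 (one_pos.trans hw1)
  have hlog : 1 ≤ Real.log ‖w‖ := (Real.le_log_iff_exp_le (norm_pos_iff.2 hw0)).2 hw
  have hre : ∀ k : ℤ, 0 < (log w + k * (2 * π * I)).re := fun k => by
    simp [log_re]
    linarith
  obtain ⟨E, hE⟩ := exists_int_equiv_fiber hbij hcomp (z₀ := log w) (by rw [log_re]; linarith)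
    (exp_log hw0)
  have hterm : ∀ k : ℤ, q (E k) / deriv f (E k) ^ 2 =
      q (φ (log w + k * (2 * π * I))) * deriv φ (log w + k * (2 * π * I)) ^ 2 / w ^ 2 := by
    intro k
    have e1 := hd _ (hre k)
    rw [hE, hfd _ (hre k), hexp, exp_log hw0]
    field_simp
  have hhas := (E.hasSum_iff.2 (hsummable w hw1).of_norm.hasSum)
  have hbound : ‖∑' z : {z : ℂ // z ∈ V ∧ f z = w}, q (z : ℂ) / (deriv f (z : ℂ)) ^ 2‖ ≤
      M / ‖w‖ ^ 2 := by
    refine le_of_tendsto hhas.norm (Eventually.of_forall fun s => ?_)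
    simp only [Function.comp_apply, hterm]
    rw [← Finset.sum_div, norm_div, norm_pow]
    gcongr
    exact hM s (log w) (by rwa [log_re])
  refine hbound.trans ?_
  gcongr
  nlinarith [one_le_pow₀ hlog (n := 2)]
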